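/- Let S and Z be random variables on finite alphabets with H(Z|S) = 0 (the semantic Z is a deterministic function of the private data S), and let ε satisfy 0 ≤ ε ≤ H(Z). Then h_ε(P_{S,Z}) = ε; that is, every U generated from (S,Z) with I(U;S) ≤ ε satisfies I(U;Z) ≤ ε, and there exists such a U with I(U;Z) = ε. -/

import Mathlib

open MeasureTheory ProbabilityTheory

/-- Shannon entropy (natural logarithm) of a random variable `X`
taking values in a finite alphabet `α`. -/
noncomputable def infH {Ω : Type*} [MeasurableSpace Ω] {α : Type*} [Fintype α]
    (P : Measure Ω) (X : Ω → α) : ℝ :=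
  ∑ a : α, Real.negMulLog (P (X ⁻¹' {a})).toReal

/-- Conditional Shannon entropy `H(X | Y)`. -/
noncomputable def infCondH {Ω : Type*} [MeasurableSpace Ω] {α β : Type*} [Fintype α] [Fintype β]
    (P : Measure Ω) (X : Ω → α) (Y : Ω → β) : ℝ :=
  infH P (fun ω => (X ω, Y ω)) - infH P Y

/-- Mutual information `I(X ; Y)`. -/
noncomputable def infMI {Ω : Type*} [MeasurableSpace Ω] {α β : Type*} [Fintype α] [Fintype β]
    (P : Measure Ω) (X : Ω → α) (Y : Ω → β) : ℝ :=
  infH P X + infH P Y - infH P (fun ω => (X ω, Y ω))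

/-- Conditional mutual information `I(X ; Y | Z)`. -/
noncomputable def infCMI {Ω : Type*} [MeasurableSpace Ω] {α β γ : Type*}
    [Fintype α] [Fintype β] [Fintype γ]
    (P : Measure Ω) (X : Ω → α) (Y : Ω → β) (Z : Ω → γ) : ℝ :=
  infCondH P X Z + infCondH P Y Z - infCondH P (fun ω => (X ω, Y ω)) Z

/-- The privacy–utility trade-off `h_ε(P_{S,Z})`: the supremum of `I(U;Z)` over all
random variables `U` (with finite alphabet), defined on some probability space carrying a
copy of `(S,Z)` with joint distribution `μ`, subject to the leakage constraint `I(U;S) ≤ ε`. -/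
noncomputable def hEps {σ ζ : Type} [Fintype σ] [MeasurableSpace σ] [MeasurableSingletonClass σ]
    [Fintype ζ] [MeasurableSpace ζ] [MeasurableSingletonClass ζ]
    (μ : Measure (σ × ζ)) (ε : ℝ) : ℝ :=
  sSup { r : ℝ | ∃ (Ω : Type) (_ : MeasurableSpace Ω) (P : Measure Ω)
    (_ : IsProbabilityMeasure P) (Sv : Ω → σ) (Zv : Ω → ζ) (n : ℕ) (U : Ω → Fin n),
    Measurable Sv ∧ Measurable Zv ∧ Measurable U ∧
    P.map (fun ω => (Sv ω, Zv ω)) = μ ∧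
    infMI P U Sv ≤ ε ∧ r = infMI P U Zv }

namespace FiniteEntropy

lemma mul_log_div_le {p q : ℝ} (hp : 0 < p) (hq : 0 < q) :
    p * (Real.log q - Real.log p) ≤ q - p := by
  rw [← Real.log_div hq.ne' hp.ne']
  calc p * Real.log (q / p) ≤ p * (q / p - 1) :=
        mul_le_mul_of_nonneg_left (Real.log_le_sub_one_of_pos (by positivity)) hp.le
    _ = q - p := by field_simp

lemma negMulLog_sum_le {α : Type*} (s : Finset α) (p : α → ℝ) (hp : ∀ a, 0 ≤ p a) :
    Real.negMulLog (∑ a ∈ s, p a) ≤ ∑ a ∈ s, Real.negMulLog (p a) := by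
  rw [Real.negMulLog, neg_mul, Finset.sum_mul, ← Finset.sum_neg_distrib]
  refine Finset.sum_le_sum fun a ha => ?_
  rw [Real.negMulLog, neg_mul, neg_le_neg_iff]
  rcases (hp a).eq_or_lt with h | h
  · simp [← h]
  · exact mul_le_mul_of_nonneg_left
      (Real.log_le_log h (Finset.single_le_sum (fun i _ => hp i) ha)) h.le

lemma sum_negMulLog_submodular {α β γ : Type*} [Fintype α] [Fintype β] [Fintype γ]
    (p : α → β → γ → ℝ) (hp : ∀ a b c, 0 ≤ p a b c) :
    ∑ a, ∑ b, ∑ c, Real.negMulLog (p a b c) + ∑ b, Real.negMulLog (∑ a, ∑ c, p a b c) ≤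
      ∑ a, ∑ b, Real.negMulLog (∑ c, p a b c) + ∑ b, ∑ c, Real.negMulLog (∑ a, p a b c) := by
  set x : α → β → ℝ := fun a b => ∑ c, p a b c with hx
  set y : β → γ → ℝ := fun b c => ∑ a, p a b c with hy
  set z : β → ℝ := fun b => ∑ a, ∑ c, p a b c with hz
  have hx0 : ∀ a b, 0 ≤ x a b := fun a b => Finset.sum_nonneg fun c _ => hp a b c
  have hy0 : ∀ b c, 0 ≤ y b c := fun b c => Finset.sum_nonneg fun a _ => hp a b c
  have hz0 : ∀ b, 0 ≤ z b := fun b => Finset.sum_nonneg fun a _ => hx0 a b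
  have hpx : ∀ a b c, p a b c ≤ x a b := fun a b c =>
    Finset.single_le_sum (fun c _ => hp a b c) (Finset.mem_univ c)
  have hpy : ∀ a b c, p a b c ≤ y b c := fun a b c =>
    Finset.single_le_sum (f := fun a => p a b c) (fun a _ => hp a b c) (Finset.mem_univ a)
  have hxz : ∀ a b, x a b ≤ z b := fun a b =>
    Finset.single_le_sum (f := fun a => x a b) (fun a _ => hx0 a b) (Finset.mem_univ a)
  have hzy : ∀ b, ∑ c, y b c = z b := fun b => Finset.sum_comm
  have key : ∀ b, ∑ a, ∑ c, (Real.negMulLog (p a b c) + p a b c * Real.log (x a b)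
      + p a b c * Real.log (y b c) - p a b c * Real.log (z b)) ≤ 0 := by
    intro b
    calc _ ≤ ∑ a, ∑ c, (x a b * y b c / z b - p a b c) := by
          refine Finset.sum_le_sum fun a _ => Finset.sum_le_sum fun c _ => ?_
          rcases (hp a b c).eq_or_lt with h | h
          · rw [← h]
            simpa using div_nonneg (mul_nonneg (hx0 a b) (hy0 b c)) (hz0 b)
          · have h1 := h.trans_le (hpx a b c)
            have h2 := h.trans_le (hpy a b c)
            have h3 := h1.trans_le (hxz a b)
            have := mul_log_div_le h (div_pos (mul_pos h1 h2) h3)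
            rw [Real.log_div (mul_pos h1 h2).ne' h3.ne', Real.log_mul h1.ne' h2.ne'] at this
            rw [Real.negMulLog]
            linarith
      _ = z b * z b / z b - z b := by
          simp only [Finset.sum_sub_distrib, ← Finset.sum_div, ← Finset.mul_sum, hzy,
            ← Finset.sum_mul]
          rfl
      _ = 0 := by rw [mul_self_div_self, sub_self]
  have total := Finset.sum_nonpos fun b (_ : b ∈ Finset.univ) => key b
  simp only [Finset.sum_sub_distrib, Finset.sum_add_distrib, ← Finset.sum_mul] at total
  have e1 : ∑ a, ∑ b, ∑ c, Real.negMulLog (p a b c)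
      = ∑ b, ∑ a, ∑ c, Real.negMulLog (p a b c) := Finset.sum_comm
  have e2 : ∑ a, ∑ b, Real.negMulLog (x a b) = -∑ b, ∑ a, x a b * Real.log (x a b) := by
    rw [Finset.sum_comm]
    simp [Real.negMulLog, Finset.sum_neg_distrib]
  have e3 : ∑ b, ∑ c, Real.negMulLog (y b c)
      = -∑ b, ∑ a, ∑ c, p a b c * Real.log (y b c) := by
    rw [← Finset.sum_neg_distrib]
    refine Finset.sum_congr rfl fun b _ => ?_
    rw [Finset.sum_comm, ← Finset.sum_neg_distrib]
    exact Finset.sum_congr rfl fun c _ => by rw [← Finset.sum_mul, Real.negMulLog, neg_mul]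
  have e4 : ∑ b, Real.negMulLog (z b) = -∑ b, z b * Real.log (z b) := by
    simp [Real.negMulLog, Finset.sum_neg_distrib]
  rw [e1, e2, e3, e4]
  linarith

section

variable {Ω α β γ : Type*} [MeasurableSpace Ω] [Fintype α] [Fintype β] [Fintype γ]
  {P : Measure Ω} [IsProbabilityMeasure P]

omit [Fintype β] in
lemma toReal_preimage_comp [DecidableEq β] {X : Ω → α} (hX : ∀ a, MeasurableSet (X ⁻¹' {a}))
    (f : α → β) (b : β) :
    (P ((fun ω => f (X ω)) ⁻¹' {b})).toReal
      = ∑ a with f a = b, (P (X ⁻¹' {a})).toReal := by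
  have h : (fun ω => f (X ω)) ⁻¹' {b} = ⋃ a ∈ Finset.univ.filter (f · = b), X ⁻¹' {a} := by
    ext ω
    simp
  rw [h, measure_biUnion_finset _ fun a _ => hX a, ENNReal.toReal_sum fun a _ => measure_ne_top _ _]
  intro a _ a' _ haa'
  exact Disjoint.preimage _ (by simpa using haa')

lemma infH_comp_le {X : Ω → α} (hX : ∀ a, MeasurableSet (X ⁻¹' {a})) (f : α → β) :
    infH P (fun ω => f (X ω)) ≤ infH P X := by
  classical
  unfold infH
  rw [← Finset.sum_fiberwise (s := Finset.univ) (g := f)]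
  refine Finset.sum_le_sum fun b _ => ?_
  rw [toReal_preimage_comp hX]
  exact negMulLog_sum_le _ _ fun a => ENNReal.toReal_nonneg

lemma infH_submodular {X : Ω → α} {Y : Ω → β} {W : Ω → γ}
    (hX : ∀ a, MeasurableSet (X ⁻¹' {a})) (hY : ∀ b, MeasurableSet (Y ⁻¹' {b}))
    (hW : ∀ c, MeasurableSet (W ⁻¹' {c})) :
    infH P (fun ω => (X ω, Y ω, W ω)) + infH P Y
      ≤ infH P (fun ω => (X ω, Y ω)) + infH P (fun ω => (Y ω, W ω)) := by
  classical
  have hT : ∀ t : α × β × γ, MeasurableSet ((fun ω => (X ω, Y ω, W ω)) ⁻¹' {t}) := by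
    rintro ⟨a, b, c⟩
    convert (hX a).inter ((hY b).inter (hW c)) using 1
    ext ω
    simp
  have h := sum_negMulLog_submodular
    (fun a b c => (P ((fun ω => (X ω, Y ω, W ω)) ⁻¹' {(a, b, c)})).toReal)
    fun a b c => ENNReal.toReal_nonneg
  have m1 : ∀ b, (P (Y ⁻¹' {b})).toReal
      = ∑ a, ∑ c, (P ((fun ω => (X ω, Y ω, W ω)) ⁻¹' {(a, b, c)})).toReal := by
    intro b
    rw [toReal_preimage_comp hT (fun t => t.2.1) b]
    simp only [Finset.sum_filter, Fintype.sum_prod_type]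
    refine Finset.sum_congr rfl fun a _ => ?_
    rw [Finset.sum_comm]
    simp
  have m2 : ∀ a b, (P ((fun ω => (X ω, Y ω)) ⁻¹' {(a, b)})).toReal
      = ∑ c, (P ((fun ω => (X ω, Y ω, W ω)) ⁻¹' {(a, b, c)})).toReal := by
    intro a b
    rw [toReal_preimage_comp hT (fun t => (t.1, t.2.1)) (a, b)]
    simp only [Finset.sum_filter, Fintype.sum_prod_type, Prod.mk.injEq, ite_and]
    rw [Fintype.sum_eq_single a (by simp_all), Finset.sum_comm]
    simp
  have m3 : ∀ b c, (P ((fun ω => (Y ω, W ω)) ⁻¹' {(b, c)})).toReal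
      = ∑ a, (P ((fun ω => (X ω, Y ω, W ω)) ⁻¹' {(a, b, c)})).toReal := by
    intro b c
    rw [toReal_preimage_comp hT (fun t => t.2) (b, c)]
    simp [Finset.sum_filter, Fintype.sum_prod_type]
  simp only [infH, Fintype.sum_prod_type, m1, m2, m3]
  exact h

/-- Data processing when `Y` is determined by `W`. -/
lemma infMI_le_of_infCondH_eq_zero {X : Ω → α} {Y : Ω → β} {W : Ω → γ}
    (hX : ∀ a, MeasurableSet (X ⁻¹' {a})) (hY : ∀ b, MeasurableSet (Y ⁻¹' {b}))
    (hW : ∀ c, MeasurableSet (W ⁻¹' {c})) (h : infCondH P Y W = 0) :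
    infMI P X Y ≤ infMI P X W := by
  have hT : ∀ t : α × β × γ, MeasurableSet ((fun ω => (X ω, Y ω, W ω)) ⁻¹' {t}) := by
    rintro ⟨a, b, c⟩
    convert (hX a).inter ((hY b).inter (hW c)) using 1
    ext ω
    simp
  have h1 := infH_submodular (P := P) hX hY hW
  have h2 := infH_comp_le (P := P) hT fun t => (t.1, t.2.2)
  unfold infCondH at h
  unfold infMI
  linarith

lemma infH_equiv_fst (P : Measure Ω) (e : α ≃ γ) (X : Ω → α) (Y : Ω → β) :
    infH P (fun ω => (e (X ω), Y ω)) = infH P (fun ω => (X ω, Y ω)) := by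
  unfold infH
  refine (Fintype.sum_equiv (e.prodCongr (Equiv.refl β)) _ _ fun t => ?_).symm
  congr 3
  ext ω
  simp [Prod.ext_iff]

lemma infH_equiv (P : Measure Ω) (e : α ≃ γ) (X : Ω → α) :
    infH P (fun ω => e (X ω)) = infH P X := by
  unfold infH
  refine (Fintype.sum_equiv e _ _ fun t => ?_).symm
  congr 3
  ext ω
  simp

lemma infMI_equiv (P : Measure Ω) (e : α ≃ γ) (X : Ω → α) (Y : Ω → β) :
    infMI P (fun ω => e (X ω)) Y = infMI P X Y := by
  unfold infMI
  rw [infH_equiv, infH_equiv_fst]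

lemma infMI_self {X : Ω → α} (hX : ∀ a, MeasurableSet (X ⁻¹' {a})) :
    infMI P X X = infH P X := by
  have hXX : ∀ t : α × α, MeasurableSet ((fun ω => (X ω, X ω)) ⁻¹' {t}) := by
    rintro ⟨a, b⟩
    convert (hX a).inter (hX b) using 1
    ext ω
    simp
  have h1 := infH_comp_le (P := P) hX fun a => (a, a)
  have h2 := infH_comp_le (P := P) hXX Prod.fst
  unfold infMI
  linarith

lemma infH_map {Ω' : Type*} [MeasurableSpace Ω'] (P : Measure Ω) {g : Ω → Ω'} (hg : Measurable g)
    {X : Ω' → α} (hX : ∀ a, MeasurableSet (X ⁻¹' {a})) :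
    infH (P.map g) X = infH P (fun ω => X (g ω)) := by
  unfold infH
  refine Finset.sum_congr rfl fun a _ => ?_
  rw [Measure.map_apply hg (hX a)]
  rfl

/-- A coin showing `true` with probability `t`. -/
noncomputable def coin (t : ℝ) : Measure Bool :=
  ENNReal.ofReal t • Measure.dirac true + ENNReal.ofReal (1 - t) • Measure.dirac false

lemma isProbabilityMeasure_coin {t : ℝ} (h0 : 0 ≤ t) (h1 : t ≤ 1) :
    IsProbabilityMeasure (coin t) := by
  constructor
  simp [coin, ← ENNReal.ofReal_add h0 (sub_nonneg.2 h1)]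

/-- The output of the erasure channel with input `X`: the coin decides whether `X` is kept. -/
def erasure (X : Ω → α) : Ω × Bool → Option α :=
  fun ω => if ω.2 then some (X ω.1) else none

lemma sum_toReal_preimage {X : Ω → α} (hX : ∀ a, MeasurableSet (X ⁻¹' {a})) :
    ∑ a, (P (X ⁻¹' {a})).toReal = 1 := by
  have h := toReal_preimage_comp (P := P) hX (fun _ => ()) ()
  simpa using h.symm

variable {t : ℝ}

omit [IsProbabilityMeasure P] in
lemma toReal_prod_coin_true (h0 : 0 ≤ t) (h1 : t ≤ 1) (s : Set Ω) :
    ((P.prod (coin t)) (s ×ˢ {true})).toReal = t * (P s).toReal := by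
  have := isProbabilityMeasure_coin h0 h1
  rw [Measure.prod_prod]
  simp [coin, h0, mul_comm]

omit [IsProbabilityMeasure P] in
lemma toReal_prod_coin_false (h0 : 0 ≤ t) (h1 : t ≤ 1) (s : Set Ω) :
    ((P.prod (coin t)) (s ×ˢ {false})).toReal = (1 - t) * (P s).toReal := by
  have := isProbabilityMeasure_coin h0 h1
  rw [Measure.prod_prod]
  simp [coin, h1, mul_comm]

lemma infH_erasure_prodMk (h0 : 0 ≤ t) (h1 : t ≤ 1) {X : Ω → α} {Y : Ω → β}
    (hX : ∀ a, MeasurableSet (X ⁻¹' {a})) (hY : ∀ b, MeasurableSet (Y ⁻¹' {b})) :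
    infH (P.prod (coin t)) (fun ω => (erasure X ω, Y ω.1))
      = Real.negMulLog t + Real.negMulLog (1 - t) + t * infH P (fun ω => (X ω, Y ω))
        + (1 - t) * infH P Y := by
  have hXY : ∀ p : α × β, MeasurableSet ((fun ω => (X ω, Y ω)) ⁻¹' {p}) := by
    rintro ⟨a, b⟩
    convert (hX a).inter (hY b) using 1
    ext ω
    simp
  have e1 : ∀ a b, (fun ω => (erasure X ω, Y ω.1)) ⁻¹' {(some a, b)}
      = ((fun ω => (X ω, Y ω)) ⁻¹' {(a, b)}) ×ˢ {true} := by
    intro a b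
    ext ⟨ω, c⟩
    cases c <;> simp [erasure]
  have e2 : ∀ b, (fun ω => (erasure X ω, Y ω.1)) ⁻¹' {(none, b)} = (Y ⁻¹' {b}) ×ˢ {false} := by
    intro b
    ext ⟨ω, c⟩
    cases c <;> simp [erasure]
  have s1 := sum_toReal_preimage (P := P) hXY
  have s2 := sum_toReal_preimage (P := P) hY
  rw [Fintype.sum_prod_type] at s1
  simp only [infH, Fintype.sum_prod_type, Fintype.sum_option, e1, e2,
    toReal_prod_coin_true h0 h1, toReal_prod_coin_false h0 h1, Real.negMulLog_mul,
    Finset.sum_add_distrib, ← Finset.mul_sum, ← Finset.sum_mul, s1, s2]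
  ring

lemma infH_erasure (h0 : 0 ≤ t) (h1 : t ≤ 1) {X : Ω → α}
    (hX : ∀ a, MeasurableSet (X ⁻¹' {a})) :
    infH (P.prod (coin t)) (erasure X)
      = Real.negMulLog t + Real.negMulLog (1 - t) + t * infH P X := by
  have e1 : ∀ a, erasure X ⁻¹' {some a} = (X ⁻¹' {a}) ×ˢ {true} := by
    intro a
    ext ⟨ω, c⟩
    cases c <;> simp [erasure]
  have e2 : erasure X ⁻¹' {none} = Set.univ ×ˢ {false} := by
    ext ⟨ω, c⟩
    cases c <;> simp [erasure]
  simp only [infH, Fintype.sum_option, e1, e2,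
    toReal_prod_coin_true h0 h1, toReal_prod_coin_false h0 h1, Real.negMulLog_mul,
    Finset.sum_add_distrib, ← Finset.mul_sum, ← Finset.sum_mul, sum_toReal_preimage hX,
    measure_univ, ENNReal.toReal_one, Real.negMulLog_one]
  ring

lemma infMI_erasure (h0 : 0 ≤ t) (h1 : t ≤ 1) {X : Ω → α} {Y : Ω → β}
    (hX : ∀ a, MeasurableSet (X ⁻¹' {a})) (hY : ∀ b, MeasurableSet (Y ⁻¹' {b})) :
    infMI (P.prod (coin t)) (erasure X) (fun ω => Y ω.1) = t * infMI P X Y := by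
  have := isProbabilityMeasure_coin h0 h1
  have h : infH (P.prod (coin t)) (fun ω => Y ω.1) = infH P Y := by
    rw [← infH_map _ measurable_fst hY, Measure.map_fst_prod, measure_univ, one_smul]
  rw [infMI, infMI, infH_erasure h0 h1 hX, infH_erasure_prodMk h0 h1 hX hY, h]
  ring

end

end FiniteEntropy

open FiniteEntropy in
/-- Let `S, Z` have joint distribution `μ = P_{S,Z}` with `H(Z|S) = 0`
(the semantic `Z` is a deterministic function of the private data `S`) and `0 ≤ ε ≤ H(Z)`.
Then `h_ε(P_{S,Z}) = ε`: every `U` generated from `(S,Z)` with `I(U;S) ≤ ε` satisfies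
`I(U;Z) ≤ ε`, and there exists such a `U` with `I(U;Z) = ε`. -/
theorem tradeoff_when_Z_determined_by_S
    {σ ζ : Type} [Fintype σ] [MeasurableSpace σ] [MeasurableSingletonClass σ]
    [Fintype ζ] [MeasurableSpace ζ] [MeasurableSingletonClass ζ]
    (μ : Measure (σ × ζ)) [IsProbabilityMeasure μ]
    (hdet : infCondH μ Prod.snd Prod.fst = 0)
    {ε : ℝ} (hε : 0 ≤ ε) (hεH : ε ≤ infH μ Prod.snd) :
    hEps μ ε = ε ∧
    (∀ (Ω : Type) (_ : MeasurableSpace Ω) (P : Measure Ω), IsProbabilityMeasure P →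
      ∀ (Sv : Ω → σ) (Zv : Ω → ζ) (n : ℕ) (U : Ω → Fin n),
        Measurable Sv → Measurable Zv → Measurable U →
        P.map (fun ω => (Sv ω, Zv ω)) = μ →
        infMI P U Sv ≤ ε → infMI P U Zv ≤ ε) ∧
    (∃ (Ω : Type) (_ : MeasurableSpace Ω) (P : Measure Ω) (_ : IsProbabilityMeasure P)
      (Sv : Ω → σ) (Zv : Ω → ζ) (n : ℕ) (U : Ω → Fin n),
      Measurable Sv ∧ Measurable Zv ∧ Measurable U ∧
      P.map (fun ω => (Sv ω, Zv ω)) = μ ∧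
      infMI P U Sv ≤ ε ∧ infMI P U Zv = ε) := by
  have hS : ∀ s : σ, MeasurableSet ((Prod.fst : σ × ζ → σ) ⁻¹' {s}) := fun s =>
    measurable_fst (measurableSet_singleton s)
  have hZ : ∀ z : ζ, MeasurableSet ((Prod.snd : σ × ζ → ζ) ⁻¹' {z}) := fun z =>
    measurable_snd (measurableSet_singleton z)
  have converse : ∀ (Ω : Type) (_ : MeasurableSpace Ω) (P : Measure Ω), IsProbabilityMeasure P →
      ∀ (Sv : Ω → σ) (Zv : Ω → ζ) (n : ℕ) (U : Ω → Fin n),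
        Measurable Sv → Measurable Zv → Measurable U →
        P.map (fun ω => (Sv ω, Zv ω)) = μ →
        infMI P U Sv ≤ ε → infMI P U Zv ≤ ε := by
    intro Ω _ P _ Sv Zv n U mS mZ mU hmap hle
    refine le_trans (infMI_le_of_infCondH_eq_zero (fun u => mU (measurableSet_singleton u))
      (fun z => mZ (measurableSet_singleton z)) (fun s => mS (measurableSet_singleton s)) ?_) hle
    subst hmap
    rwa [infCondH, infH_map P (mS.prodMk mZ) hS, infH_map P (mS.prodMk mZ)
      (fun p => MeasurableSet.of_discrete)] at hdet
  have achieve : ∃ (Ω : Type) (_ : MeasurableSpace Ω) (P : Measure Ω) (_ : IsProbabilityMeasure P)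
      (Sv : Ω → σ) (Zv : Ω → ζ) (n : ℕ) (U : Ω → Fin n),
      Measurable Sv ∧ Measurable Zv ∧ Measurable U ∧
      P.map (fun ω => (Sv ω, Zv ω)) = μ ∧
      infMI P U Sv ≤ ε ∧ infMI P U Zv = ε := by
    obtain ⟨t, h0, h1, ht⟩ : ∃ t : ℝ, 0 ≤ t ∧ t ≤ 1 ∧ t * infH μ Prod.snd = ε := by
      rcases (hε.trans hεH).eq_or_lt with h | h
      · exact ⟨0, le_rfl, zero_le_one, by linarith⟩
      · exact ⟨ε / infH μ Prod.snd, div_nonneg hε h.le, (div_le_one h).2 hεH,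
          div_mul_cancel₀ _ h.ne'⟩
    have := isProbabilityMeasure_coin h0 h1
    refine ⟨(σ × ζ) × Bool, inferInstance, μ.prod (coin t), inferInstance,
      fun ω => ω.1.1, fun ω => ω.1.2, Fintype.card (Option ζ),
      fun ω => Fintype.equivFin (Option ζ) (erasure Prod.snd ω),
      by fun_prop, by fun_prop, Measurable.of_discrete, ?_, ?_, ?_⟩
    · exact Measure.map_fst_prod.trans (by rw [measure_univ, one_smul])
    · rw [infMI_equiv, infMI_erasure h0 h1 hZ hS, ← ht]
      unfold infCondH at hdet
      unfold infMI
      refine (congrArg (t * ·) ?_).le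
      linarith
    · rw [infMI_equiv, infMI_erasure h0 h1 hZ hZ, infMI_self hZ, ht]
  refine ⟨IsGreatest.csSup_eq ⟨?_, ?_⟩, converse, achieve⟩
  · obtain ⟨Ω, m, P, hP, Sv, Zv, n, U, mS, mZ, mU, hmap, hle, heq⟩ := achieve
    exact ⟨Ω, m, P, hP, Sv, Zv, n, U, mS, mZ, mU, hmap, hle, heq.symm⟩
  · rintro _ ⟨Ω, m, P, hP, Sv, Zv, n, U, mS, mZ, mU, hmap, hle, rfl⟩
    exact converse Ω m P hP Sv Zv n U mS mZ mU hmap hle
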